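/- Let f : {0,1}^n → {-1,1} and let X_0^1, X_1^1, ..., X_0^n, X_1^n be any real numbers each taking a value in {-1, 1}. Then -1 ≤ ∑_{s ∈ {0,1}^n} β_f(s) · X_{s_1}^1 · X_{s_2}^2 · ... · X_{s_n}^n ≤ 1. (These are the facet inequalities of the classical correlation polytope C_n of Werner–Wolf and Zukowski–Brukner.) -/

import Mathlib

/-- The Fourier coefficient `β_f(s) = 2^{-n} ∑_{ε ∈ {0,1}^n} (-1)^{ε·s} f(ε)`. -/
noncomputable def wwBeta (n : ℕ) (f : (Fin n → Fin 2) → ℝ) (s : Fin n → Fin 2) : ℝ :=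
  ((2 : ℝ) ^ n)⁻¹ *
    ∑ ε : Fin n → Fin 2, (-1 : ℝ) ^ (∑ j, (ε j : ℕ) * (s j : ℕ)) * f ε

/-- Expanding the coefficients and exchanging the sums turns the correlation expression into
an average of `f` against product weights. -/
theorem sum_wwBeta_mul_prod (n : ℕ) (f : (Fin n → Fin 2) → ℝ) (X : Fin n → Fin 2 → ℝ) :
    ∑ s : Fin n → Fin 2, wwBeta n f s * ∏ j, X j (s j) =
      ∑ ε : Fin n → Fin 2, f ε * ∏ j, (X j 0 + (-1) ^ (ε j : ℕ) * X j 1) / 2 := by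
  have key (ε : Fin n → Fin 2) : ∏ j, (X j 0 + (-1) ^ (ε j : ℕ) * X j 1) / 2 =
      ((2 : ℝ) ^ n)⁻¹ * ∑ s : Fin n → Fin 2,
        (-1 : ℝ) ^ (∑ j, (ε j : ℕ) * (s j : ℕ)) * ∏ j, X j (s j) := by
    have h (j : Fin n) : X j 0 + (-1) ^ (ε j : ℕ) * X j 1 =
        ∑ b : Fin 2, (-1 : ℝ) ^ ((ε j : ℕ) * (b : ℕ)) * X j b := by
      simp [Fin.sum_univ_two]
    rw [Finset.prod_div_distrib, Finset.prod_congr rfl fun j _ => h j, Finset.prod_univ_sum,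
      Fintype.piFinset_univ]
    simp only [Finset.prod_mul_distrib, Finset.prod_pow_eq_pow_sum, Finset.prod_const,
      Finset.card_univ, Fintype.card_fin]
    rw [div_eq_inv_mul]
  simp only [key, wwBeta, Finset.mul_sum, Finset.sum_mul]
  rw [Finset.sum_comm]
  refine Finset.sum_congr rfl fun ε _ => Finset.sum_congr rfl fun s _ => ?_
  ring

/-- The product weights attached to deterministic outcomes have total absolute mass one. -/
theorem sum_abs_prod_half_eq_one (n : ℕ) (X : Fin n → Fin 2 → ℝ)
    (hX : ∀ j s, X j s = 1 ∨ X j s = -1) :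
    ∑ ε : Fin n → Fin 2, |∏ j, (X j 0 + (-1) ^ (ε j : ℕ) * X j 1) / 2| = 1 := by
  have h (j : Fin n) : ∑ b : Fin 2, |(X j 0 + (-1) ^ (b : ℕ) * X j 1) / 2| = 1 := by
    rcases hX j 0 with h0 | h0 <;> rcases hX j 1 with h1 | h1 <;>
      norm_num [Fin.sum_univ_two, h0, h1]
  simp only [Finset.abs_prod]
  rw [← Fintype.piFinset_univ, ← Finset.prod_univ_sum (fun _ => Finset.univ)
    (fun j (b : Fin 2) => |(X j 0 + (-1) ^ (b : ℕ) * X j 1) / 2|)]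
  exact Finset.prod_eq_one fun j _ => h j

/-- **Facet inequalities of the classical correlation polytope `Cₙ`**
(Werner–Wolf, Żukowski–Brukner).  For any `f : {0,1}^n → {-1,1}` and any real
numbers `X_s^j ∈ {-1,1}` (`j = 1,…,n`, `s ∈ {0,1}`, written `X j s`):
`-1 ≤ ∑_{s ∈ {0,1}^n} β_f(s) · X_{s₁}¹ · X_{s₂}² ⋯ X_{s_n}ⁿ ≤ 1`. -/
theorem wwFacet (n : ℕ) (f : (Fin n → Fin 2) → ℝ)
    (hf : ∀ ε, f ε = 1 ∨ f ε = -1)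
    (X : Fin n → Fin 2 → ℝ) (hX : ∀ j s, X j s = 1 ∨ X j s = -1) :
    -1 ≤ (∑ s : Fin n → Fin 2, wwBeta n f s * ∏ j, X j (s j)) ∧
      (∑ s : Fin n → Fin 2, wwBeta n f s * ∏ j, X j (s j)) ≤ 1 := by
  rw [← abs_le, sum_wwBeta_mul_prod]
  refine (Finset.abs_sum_le_sum_abs _ _).trans ((Eq.le ?_).trans (sum_abs_prod_half_eq_one n X hX).le)
  refine Finset.sum_congr rfl fun ε _ => ?_
  rw [abs_mul, (abs_eq zero_le_one).mpr (hf ε), one_mul]
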